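/- (Core of the exclusion of soliton-like and low-to-high cascade solutions.) Let d ≥ 1, c > 0, C₀ > 0, C₁ > 0, and let F : [0,∞) × ℝ^d → [0,∞) be measurable. Suppose (i) for every T > 0, ∫_0^T ∫_{ℝ^d} F(t,x)/|x| dx dt ≤ C₀; and (ii) for every integer k ≥ 0 there exists x_k ∈ ℝ^d with |x_k| ≤ k + C₁ such that ∫_k^{k+1} ∫_{|x − x_k| ≤ C₁} F(t,x) dx dt ≥ c. Then a contradiction follows; that is, no such F exists. -/

import Mathlib

open MeasureTheory
open scoped ENNReal

noncomputable section

/-- Euclidean space `ℝ^d`. -/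
abbrev Ed (d : ℕ) : Type := EuclideanSpace ℝ (Fin d)

/-- On a ball about `y` the weight `‖x‖⁻¹` is at least `K⁻¹` as soon as `‖y‖ + r ≤ K`, whence the
unweighted integral over the ball is at most `K` times the weighted one. -/
theorem lintegral_closedBall_le_mul_lintegral_div_norm {E : Type*} [NormedAddCommGroup E]
    [MeasurableSpace E] [OpensMeasurableSpace E] (μ : Measure E) [NullSingletonClass μ]
    (f : E → ℝ) (hf : ∀ x, 0 ≤ f x)
    {y : E} {r K : ℝ} (hK : ‖y‖ + r ≤ K) :
    ∫⁻ x in Metric.closedBall y r, ENNReal.ofReal (f x) ∂μ ≤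
      ENNReal.ofReal K * ∫⁻ x, ENNReal.ofReal (f x / ‖x‖) ∂μ := by
  rw [← lintegral_const_mul' _ _ ENNReal.ofReal_ne_top]
  have h_ne : ∀ᵐ x ∂μ, x ≠ 0 := by simp [ae_iff]
  refine (setLIntegral_mono_ae' (g := fun x => ENNReal.ofReal K * ENNReal.ofReal (f x / ‖x‖))
    Metric.isClosed_closedBall.measurableSet ?_).trans (setLIntegral_le_lintegral _ _)
  filter_upwards [h_ne] with x hx hxy
  have hx_pos : 0 < ‖x‖ := norm_pos_iff.2 hx
  have hx_le : ‖x‖ ≤ K := by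
    have h_tri := norm_le_norm_add_norm_sub y x
    rw [← dist_eq_norm, dist_comm] at h_tri
    linarith [Metric.mem_closedBall.1 hxy]
  rw [← ENNReal.ofReal_mul (hx_pos.le.trans hx_le)]
  refine ENNReal.ofReal_le_ofReal ?_
  rw [mul_div_assoc', le_div_iff₀ hx_pos, mul_comm]
  exact mul_le_mul_of_nonneg_right hx_le (hf x)

/-- The integrals over the unit intervals `[k, k + 1)`, `k < n`, add up to that over `[0, n)`. -/
theorem sum_range_lintegral_Ico_natCast (g : ℝ → ℝ≥0∞) (n : ℕ) :
    ∑ k ∈ Finset.range n, ∫⁻ t in Set.Ico (k : ℝ) (k + 1), g t =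
      ∫⁻ t in Set.Ico 0 (n : ℝ), g t := by
  induction n with
  | zero => simp
  | succ n ih =>
    have h_union : Set.Ico (0 : ℝ) n ∪ Set.Ico (n : ℝ) (n + 1) = Set.Ico 0 ((n : ℝ) + 1) :=
      Set.Ico_union_Ico_eq_Ico n.cast_nonneg (by linarith)
    rw [Finset.sum_range_succ, ih, Nat.cast_succ, ← h_union,
      lintegral_union measurableSet_Ico Set.Ico_disjoint_Ico_same]

/-- Core of the exclusion of soliton-like and low-to-high cascade solutions:
a nonnegative measurable `F` on `[0,∞) × ℝ^d` cannot simultaneously satisfy a uniform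
Morawetz bound `∫_0^T ∫ F(t,x)/|x| ≤ C₀` and a uniform concentration lower bound
`∫_k^{k+1} ∫_{|x-x_k|≤C₁} F ≥ c` with `|x_k| ≤ k + C₁`. -/
theorem stmt16 (d : ℕ) (hd : 1 ≤ d) (c C₀ C₁ : ℝ) (hc : 0 < c) (hC₀ : 0 < C₀)
    (hC₁ : 0 < C₁) (F : ℝ → Ed d → ℝ)
    (hF_meas : Measurable (Function.uncurry F))
    (hF_nonneg : ∀ t x, 0 ≤ F t x)
    (hmor : ∀ T : ℝ, 0 < T →
      (∫⁻ t in Set.Icc 0 T, ∫⁻ x : Ed d, ENNReal.ofReal (F t x / ‖x‖))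
        ≤ ENNReal.ofReal C₀)
    (hconc : ∀ k : ℕ, ∃ xk : Ed d, ‖xk‖ ≤ (k : ℝ) + C₁ ∧
      ENNReal.ofReal c ≤
        ∫⁻ t in Set.Icc (k : ℝ) ((k : ℝ) + 1),
          ∫⁻ x in Metric.closedBall xk C₁, ENNReal.ofReal (F t x)) :
    False := by
  have : Nonempty (Fin d) := ⟨⟨0, hd⟩⟩
  set G : ℝ → ℝ≥0∞ := fun t => ∫⁻ x : Ed d, ENNReal.ofReal (F t x / ‖x‖) with hG
  have h_slab : ∀ k : ℕ, ENNReal.ofReal (c / (1 + 2 * C₁) * (1 / ((k : ℝ) + 1))) ≤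
      ∫⁻ t in Set.Ico (k : ℝ) (k + 1), G t := by
    intro k
    obtain ⟨y, hy, h_le⟩ := hconc k
    have hK : 0 < (1 + 2 * C₁) * ((k : ℝ) + 1) := by positivity
    have hyK : ‖y‖ + C₁ ≤ (1 + 2 * C₁) * ((k : ℝ) + 1) := by
      nlinarith [mul_nonneg hC₁.le k.cast_nonneg (α := ℝ)]
    have h_weight := h_le.trans (lintegral_mono fun t =>
      lintegral_closedBall_le_mul_lintegral_div_norm volume (F t) (hF_nonneg t) hyK)
    rw [lintegral_const_mul' _ _ ENNReal.ofReal_ne_top,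
      ← setLIntegral_congr Ico_ae_eq_Icc] at h_weight
    rw [div_mul_div_comm, mul_one, ENNReal.ofReal_div_of_pos hK]
    exact ENNReal.div_le_of_le_mul' h_weight
  have h_bound : ∀ n : ℕ,
      c / (1 + 2 * C₁) * ∑ k ∈ Finset.range n, 1 / ((k : ℝ) + 1) ≤ C₀ := by
    intro n
    rw [← ENNReal.ofReal_le_ofReal_iff hC₀.le, Finset.mul_sum,
      ENNReal.ofReal_sum_of_nonneg fun k _ => by positivity]
    calc
      _ ≤ ∑ k ∈ Finset.range n, ∫⁻ t in Set.Ico (k : ℝ) (k + 1), G t :=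
        Finset.sum_le_sum fun k _ => h_slab k
      _ = ∫⁻ t in Set.Ico 0 (n : ℝ), G t := sum_range_lintegral_Ico_natCast G n
      _ ≤ ∫⁻ t in Set.Icc 0 ((n : ℝ) + 1), G t := lintegral_mono_set fun t ht =>
        ⟨ht.1, by linarith [ht.2]⟩
      _ ≤ ENNReal.ofReal C₀ := hmor _ (by positivity)
  have h_div := Real.tendsto_sum_range_one_div_nat_succ_atTop.const_mul_atTop
    (show 0 < c / (1 + 2 * C₁) by positivity)
  obtain ⟨n, hn⟩ := (h_div.eventually_gt_atTop C₀).exists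
  exact (h_bound n).not_gt hn
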